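/- Fix ω₀ ∈ ℝ³ and N ≥ 1. Let r₀, x₀ : ℝ → ℝ³ be C¹ with ṙ₀ = x₀ and ẋ₀ = ω₀ × x₀ (the virtual particle), and let r_1, …, r_N, x_1, …, x_N : ℝ → ℝ³ be C¹ with ‖x_k(t)‖ = 1 for all t and all k, satisfying ṙ_k = x_k and ẋ_k = u_k^a × x_k with the symmetry-breaking control u_k^a = ω₀ + ( v_k − ṽ_av ) × x_k, where v_j = x_j + r_j × ω₀ for j = 0, 1, …, N and ṽ_av = (1/(N+1)) ∑_{j=0}^N v_j. Then v₀ is constant, and the function S̃(t) = (1/2) ∑_{j=0}^N ‖v_j(t) − ṽ_av(t)‖² satisfies S̃'(t) = − ∑_{k=1}^N ‖( v_k(t) − ṽ_av(t) ) × x_k(t)‖² ≤ 0 for all t. -/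

import Mathlib

noncomputable section

/-- Euclidean norm on `ℝ³` (represented as `Fin 3 → ℝ`). -/
def norm3 (v : Fin 3 → ℝ) : ℝ := Real.sqrt (∑ i, v i ^ 2)

/-- The cross product on `ℝ³`. -/
def cross3 (u v : Fin 3 → ℝ) : Fin 3 → ℝ := crossProduct u v

open Matrix

lemma norm3_sq (v : Fin 3 → ℝ) : norm3 v ^ 2 = v ⬝ᵥ v := by
  rw [norm3, Real.sq_sqrt (Finset.sum_nonneg fun i _ => sq_nonneg _)]
  simp [dotProduct, sq]

lemma hasDerivAt_norm3_sq {f : ℝ → Fin 3 → ℝ} {f' : Fin 3 → ℝ} {t : ℝ}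
    (hf : HasDerivAt f f' t) :
    HasDerivAt (fun s => norm3 (f s) ^ 2) (2 * (f t ⬝ᵥ f')) t := by
  have hcoord := hasDerivAt_pi.1 hf
  have hsum : HasDerivAt (fun s => ∑ i, f s i * f s i)
      (∑ i, (f' i * f t i + f t i * f' i)) t :=
    HasDerivAt.fun_sum fun i _ => (hcoord i).mul (hcoord i)
  simp only [norm3_sq]
  refine hsum.congr_deriv ?_
  rw [dotProduct, Finset.mul_sum]
  exact Finset.sum_congr rfl fun i _ => by ring

lemma hasDerivAt_cross3_const {f : ℝ → Fin 3 → ℝ} {f' : Fin 3 → ℝ} {t : ℝ}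
    (hf : HasDerivAt f f' t) (ω : Fin 3 → ℝ) :
    HasDerivAt (fun s => cross3 (f s) ω) (cross3 f' ω) t :=
  (LinearMap.toContinuousLinearMap (crossProduct.flip ω)).hasFDerivAt.comp_hasDerivAt t hf

lemma dotProduct_cross3_cross3 (w x : Fin 3 → ℝ) :
    w ⬝ᵥ cross3 (cross3 w x) x = -norm3 (cross3 w x) ^ 2 := by
  simp only [norm3_sq, cross3, cross_apply, dotProduct, Fin.sum_univ_three]
  simp
  ring

/-- The translational twist component `x + r × ω` of a particle with angular velocity `ω + q`
has derivative `q × x`. -/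
lemma hasDerivAt_twist {r x : ℝ → Fin 3 → ℝ} {ω q : Fin 3 → ℝ} {t : ℝ}
    (hr : HasDerivAt r (x t) t) (hx : HasDerivAt x (cross3 (ω + q) (x t)) t) :
    HasDerivAt (fun s => x s + cross3 (r s) ω) (cross3 q (x t)) t := by
  refine (hx.add (hasDerivAt_cross3_const hr ω)).congr_deriv ?_
  rw [cross3, cross3, cross3, map_add, LinearMap.add_apply, ← cross_anticomm (x t) ω]
  abel

/-- With a virtual particle (`ṙ₀ = x₀`, `ẋ₀ = ω₀ × x₀`) and the
symmetry-breaking control `u_k^a = ω₀ + (v_k − ṽ_av) × x_k`, where `v_j = x_j + r_j × ω₀` for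
`j = 0, 1, …, N` and `ṽ_av = (1/(N+1)) ∑_{j=0}^N v_j`, the virtual twist component `v₀` is
constant and `S̃ = (1/2) ∑_{j=0}^N ‖v_j − ṽ_av‖²` satisfies
`S̃' = − ∑_{k=1}^N ‖(v_k − ṽ_av) × x_k‖² ≤ 0`. -/
theorem symmetry_breaking_lyapunov
    (N : ℕ) (hN : 1 ≤ N) (ω₀ : Fin 3 → ℝ)
    (r₀ x₀ : ℝ → Fin 3 → ℝ)
    (hr₀ : ∀ t, HasDerivAt r₀ (x₀ t) t)
    (hx₀ : ∀ t, HasDerivAt x₀ (cross3 ω₀ (x₀ t)) t)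
    (r x : Fin N → ℝ → Fin 3 → ℝ)
    (hunit : ∀ k t, norm3 (x k t) = 1)
    (v₀ : ℝ → Fin 3 → ℝ)
    (hv₀ : ∀ t, v₀ t = x₀ t + cross3 (r₀ t) ω₀)
    (v : Fin N → ℝ → Fin 3 → ℝ)
    (hv : ∀ k t, v k t = x k t + cross3 (r k t) ω₀)
    (vav : ℝ → Fin 3 → ℝ)
    (hvav : ∀ t, vav t = ((N : ℝ) + 1)⁻¹ • (v₀ t + ∑ j, v j t))
    (hr : ∀ k t, HasDerivAt (r k) (x k t) t)
    (hx : ∀ k t, HasDerivAt (x k)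
      (cross3 (ω₀ + cross3 (v k t - vav t) (x k t)) (x k t)) t) :
    (∀ t, v₀ t = v₀ 0) ∧
    (∀ t,
      HasDerivAt
        (fun s => (1 / 2 : ℝ) * (norm3 (v₀ s - vav s) ^ 2 + ∑ k, norm3 (v k s - vav s) ^ 2))
        (-(∑ k, norm3 (cross3 (v k t - vav t) (x k t)) ^ 2)) t ∧
      -(∑ k, norm3 (cross3 (v k t - vav t) (x k t)) ^ 2) ≤ 0) := by
  have hv₀' (t : ℝ) : HasDerivAt v₀ 0 t := by
    have h := hasDerivAt_twist (q := 0) (hr₀ t) (by simpa using hx₀ t)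
    rw [← funext hv₀] at h
    simpa [cross3] using h
  have hv' (k : Fin N) (t : ℝ) :
      HasDerivAt (v k) (cross3 (cross3 (v k t - vav t) (x k t)) (x k t)) t := by
    have h := hasDerivAt_twist (hr k t) (hx k t)
    rwa [← funext (hv k)] at h
  refine ⟨fun t => is_const_of_deriv_eq_zero (fun s => (hv₀' s).differentiableAt)
    (fun s => (hv₀' s).deriv) t 0, fun t => ⟨?_, ?_⟩⟩
  · obtain ⟨a, hvav'⟩ : ∃ a, HasDerivAt vav a t := by
      refine ⟨_, HasDerivAt.congr_of_eventuallyEq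
        (((hv₀' t).add (HasDerivAt.fun_sum fun k (_ : k ∈ Finset.univ) => hv' k t)).const_smul
          ((N : ℝ) + 1)⁻¹) (.of_forall hvav)⟩
    have hdev : (v₀ t - vav t) + ∑ k, (v k t - vav t) = 0 := by
      have hN' : (N : ℝ) + 1 ≠ 0 := by positivity
      have h : ((N : ℝ) + 1) • vav t = v₀ t + ∑ j, v j t := by
        rw [hvav, smul_inv_smul₀ hN']
      rw [Finset.sum_sub_distrib, sub_add_sub_comm, ← h]
      simp only [Finset.sum_const, Finset.card_univ, Fintype.card_fin, add_smul, one_smul,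
        Nat.cast_smul_eq_nsmul]
      abel
    have hdot : (v₀ t - vav t) ⬝ᵥ a + ∑ k, (v k t - vav t) ⬝ᵥ a = 0 := by
      rw [← sum_dotProduct, ← add_dotProduct, hdev, zero_dotProduct]
    refine (((hasDerivAt_norm3_sq ((hv₀' t).sub hvav')).add
      (HasDerivAt.fun_sum fun k (_ : k ∈ Finset.univ) =>
        hasDerivAt_norm3_sq ((hv' k t).sub hvav'))).const_mul (1 / 2 : ℝ)).congr_deriv ?_
    simp only [Pi.sub_apply, dotProduct_sub, dotProduct_zero, dotProduct_cross3_cross3,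
      ← Finset.mul_sum, Finset.sum_sub_distrib, Finset.sum_neg_distrib]
    linarith
  · exact neg_nonpos.2 (Finset.sum_nonneg fun k _ => sq_nonneg _)
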